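/- arXiv:0709.1420 — 2 statements merged into one kernel-verified Lean document; each statement's English description precedes it below -/
import Mathlib

section
/- Let φ, ψ : U^n → U^n be holomorphic, and suppose the difference of composition operators C_φ − C_ψ : B → H^∞, f ↦ f∘φ − f∘ψ, is a bounded linear operator from the Bloch space B of U^n to H^∞(U^n). Then the essential norm satisfies ‖C_φ − C_ψ‖_e ≥ (1/4) · lim_{δ→0⁺} sup_{z∈E_δ} |||φ_{φ(z)}(ψ(z))|||, where E_δ = {z ∈ U^n : max(|||φ(z)|||, |||ψ(z)|||) > 1 − δ} and φ_a denotes the Möbius automorphism of U^n associated to a. -/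
open Complex Metric Set Filter
open scoped Topology BigOperators

noncomputable section

/-- The unit polydisc `U^n` in `ℂ^n`; the norm on `Fin n → ℂ` is the sup norm
`|||z||| = max_j |z_j|`. -/
def polyDisc (n : ℕ) : Set (Fin n → ℂ) := {z | ‖z‖ < 1}

/-- `Σ_{j=1}^n (1 - |z_j|²) |∂f/∂z_j(z)|`. -/
def blochSum (n : ℕ) (f : (Fin n → ℂ) → ℂ) (z : Fin n → ℂ) : ℝ :=
  ∑ j : Fin n, (1 - ‖z j‖ ^ 2) * ‖fderiv ℂ f z (Pi.single j 1)‖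

/-- The Bloch norm `‖f‖ = |f(0)| + sup_{z ∈ Uⁿ} Σ_j (1-|z_j|²)|∂f/∂z_j(z)|`. -/
def blochNorm (n : ℕ) (f : (Fin n → ℂ) → ℂ) : ℝ :=
  ‖f 0‖ + sSup (blochSum n f '' polyDisc n)

/-- Membership in the Bloch space of `Uⁿ`: holomorphic on `Uⁿ` with finite Bloch norm. -/
def InBloch (n : ℕ) (f : (Fin n → ℂ) → ℂ) : Prop :=
  DifferentiableOn ℂ f (polyDisc n) ∧ BddAbove (blochSum n f '' polyDisc n)

/-- The Möbius automorphism `φ_a` of the polydisc: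
`φ_a(w)_j = (w_j - a_j)/(1 - conj(a_j) w_j)`. -/
def mobius (n : ℕ) (a w : Fin n → ℂ) : Fin n → ℂ :=
  fun j => (w j - a j) / (1 - (starRingEnd ℂ) (a j) * w j)

/-- The Kobayashi distance on the polydisc:
`k_{Uⁿ}(z,w) = (1/2) log((1 + |||φ_z(w)|||)/(1 - |||φ_z(w)|||))`. -/
def kobayashi (n : ℕ) (z w : Fin n → ℂ) : ℝ :=
  (1 / 2) * Real.log ((1 + ‖mobius n z w‖) / (1 - ‖mobius n z w‖))

/-- The `H^∞` (sup) norm of `g` over the polydisc: `‖g‖_∞ = sup_{z ∈ Uⁿ} |g(z)|`. -/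
def supNorm (n : ℕ) (g : (Fin n → ℂ) → ℂ) : ℝ :=
  ⨆ z : polyDisc n, ‖g (z : Fin n → ℂ)‖

/-- The difference of composition operators `C_φ - C_ψ : f ↦ f∘φ - f∘ψ`. -/
def compOpDiff (n : ℕ) (φ ψ : (Fin n → ℂ) → Fin n → ℂ) :
    ((Fin n → ℂ) → ℂ) → (Fin n → ℂ) → ℂ :=
  fun f => f ∘ φ - f ∘ ψ

/-- Boundedness of an operator from the Bloch space to `H^∞`. -/
def IsBddOp (n : ℕ) (T : ((Fin n → ℂ) → ℂ) → (Fin n → ℂ) → ℂ) : Prop :=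
  ∃ C : ℝ, ∀ f, InBloch n f → supNorm n (T f) ≤ C * blochNorm n f

/-- The operator norm of `T` from the Bloch space to `H^∞`:
the supremum of `‖T f‖_∞` over the unit ball of the Bloch space. -/
def opNorm (n : ℕ) (T : ((Fin n → ℂ) → ℂ) → (Fin n → ℂ) → ℂ) : ℝ :=
  sSup {t : ℝ | ∃ f, InBloch n f ∧ blochNorm n f ≤ 1 ∧ t = supNorm n (T f)}

/-- `T` is linear on the Bloch space (values only matter on the polydisc). -/
def IsLinOp (n : ℕ) (T : ((Fin n → ℂ) → ℂ) → (Fin n → ℂ) → ℂ) : Prop :=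
  (∀ f g, InBloch n f → InBloch n g →
    ∀ z ∈ polyDisc n, T (f + g) z = T f z + T g z) ∧
  (∀ (c : ℂ) (f), InBloch n f → ∀ z ∈ polyDisc n, T (c • f) z = c * T f z)

/-- `T` sends Bloch functions to `H^∞` functions (bounded and holomorphic on `Uⁿ`). -/
def MapsToHinf (n : ℕ) (T : ((Fin n → ℂ) → ℂ) → (Fin n → ℂ) → ℂ) : Prop :=
  ∀ f, InBloch n f → DifferentiableOn ℂ (T f) (polyDisc n) ∧
    BddAbove ((fun z => ‖T f z‖) '' polyDisc n)

/-- Compactness of a linear operator `T` from the Bloch space to `H^∞`: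
every sequence in the unit ball of the Bloch space has a subsequence whose image
under `T` is Cauchy in the `H^∞` norm. -/
def IsCompactOp (n : ℕ) (T : ((Fin n → ℂ) → ℂ) → (Fin n → ℂ) → ℂ) : Prop :=
  IsLinOp n T ∧ MapsToHinf n T ∧
  ∀ F : ℕ → (Fin n → ℂ) → ℂ, (∀ m, InBloch n (F m) ∧ blochNorm n (F m) ≤ 1) →
    ∃ s : ℕ → ℕ, StrictMono s ∧
      ∀ ε : ℝ, 0 < ε → ∃ N : ℕ, ∀ k ≥ N, ∀ k' ≥ N,
        supNorm n (T (F (s k)) - T (F (s k'))) ≤ ε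

/-- The essential norm of `T : B → H^∞`: the distance from `T` to the compact operators,
`‖T‖_e = inf {‖T - K‖ : K compact}`. -/
def essNorm (n : ℕ) (T : ((Fin n → ℂ) → ℂ) → (Fin n → ℂ) → ℂ) : ℝ :=
  sInf {t : ℝ | ∃ K, IsCompactOp n K ∧ t = opNorm n (T - K)}

/-- `E_δ = {z ∈ Uⁿ : max(|||φ(z)|||, |||ψ(z)|||) > 1 - δ}`. -/
def Eset (n : ℕ) (φ ψ : (Fin n → ℂ) → Fin n → ℂ) (δ : ℝ) : Set (Fin n → ℂ) :=
  {z ∈ polyDisc n | 1 - δ < max ‖φ z‖ ‖ψ z‖}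

lemma norm_apply_lt_one {n : ℕ} {w : Fin n → ℂ} (hw : w ∈ polyDisc n) (j : Fin n) :
    ‖w j‖ < 1 :=
  (norm_le_pi_norm w j).trans_lt hw

lemma isOpen_polyDisc (n : ℕ) : IsOpen (polyDisc n) :=
  isOpen_lt continuous_norm continuous_const

lemma zero_mem_polyDisc (n : ℕ) : (0 : Fin n → ℂ) ∈ polyDisc n := by
  simp [polyDisc]

instance (n : ℕ) : Nonempty (polyDisc n) := ⟨⟨0, zero_mem_polyDisc n⟩⟩

lemma norm_le_supNorm {n : ℕ} {g : (Fin n → ℂ) → ℂ}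
    (hg : BddAbove ((fun z => ‖g z‖) '' polyDisc n)) {z : Fin n → ℂ} (hz : z ∈ polyDisc n) :
    ‖g z‖ ≤ supNorm n g := by
  have h : BddAbove (range fun z : polyDisc n => ‖g z‖) := by
    rwa [image_eq_range] at hg
  exact le_ciSup h ⟨z, hz⟩

lemma supNorm_le {n : ℕ} {g : (Fin n → ℂ) → ℂ} {M : ℝ}
    (h : ∀ z ∈ polyDisc n, ‖g z‖ ≤ M) : supNorm n g ≤ M :=
  ciSup_le fun z => h z z.2

lemma bddAbove_norm_image {n : ℕ} {g : (Fin n → ℂ) → ℂ} {M : ℝ}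
    (h : ∀ z ∈ polyDisc n, ‖g z‖ ≤ M) : BddAbove ((fun z => ‖g z‖) '' polyDisc n) :=
  ⟨M, forall_mem_image.2 h⟩

lemma supNorm_of_not_bddAbove {n : ℕ} {g : (Fin n → ℂ) → ℂ}
    (h : ¬ BddAbove ((fun z => ‖g z‖) '' polyDisc n)) : supNorm n g = 0 := by
  rw [image_eq_range] at h
  exact Real.iSup_of_not_bddAbove h

/-- A compact operator is bounded on the unit ball of the Bloch space. -/
lemma IsCompactOp.exists_bound {n : ℕ} {K : ((Fin n → ℂ) → ℂ) → (Fin n → ℂ) → ℂ}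
    (hK : IsCompactOp n K) :
    ∃ M : ℝ, ∀ f, InBloch n f → blochNorm n f ≤ 1 → ∀ z ∈ polyDisc n, ‖K f z‖ ≤ M := by
  obtain ⟨-, hmap, hseq⟩ := hK
  by_contra! hcon
  choose F hF hF1 z hz hFz using fun m : ℕ => hcon m
  obtain ⟨s, hs, hC⟩ := hseq F fun m => ⟨hF m, hF1 m⟩
  obtain ⟨N, hN⟩ := hC 1 one_pos
  obtain ⟨B, hB⟩ := (hmap (F (s N)) (hF _)).2
  obtain ⟨k, hk⟩ := exists_nat_gt (B + 1)
  set m := max k N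
  have hbd : BddAbove ((fun w => ‖(K (F (s m)) - K (F (s N))) w‖) '' polyDisc n) := by
    obtain ⟨B', hB'⟩ := (hmap (F (s m)) (hF _)).2
    refine bddAbove_norm_image (M := B' + B) fun w hw => ?_
    exact (norm_sub_le _ _).trans
      (add_le_add (hB' (mem_image_of_mem _ hw)) (hB (mem_image_of_mem _ hw)))
  have h1 := (norm_le_supNorm hbd (hz (s m))).trans (hN m (le_max_right _ _) N le_rfl)
  have h2 : ‖K (F (s N)) (z (s m))‖ ≤ B := hB (mem_image_of_mem _ (hz _))
  have h3 := hFz (s m)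
  have h4 : (k : ℝ) ≤ s m := by exact_mod_cast (le_max_left k N).trans (hs.id_le m)
  have h5 := norm_sub_norm_le (K (F (s m)) (z (s m))) (K (F (s N)) (z (s m)))
  rw [Pi.sub_apply] at h1
  linarith

/-- For a compact perturbation of a bounded operator, the operator norm controls every value at a
function of the unit ball with bounded image. -/
lemma norm_sub_apply_le_opNorm {n : ℕ} {T K : ((Fin n → ℂ) → ℂ) → (Fin n → ℂ) → ℂ}
    (hT : IsBddOp n T) (hK : IsCompactOp n K) {f : (Fin n → ℂ) → ℂ} (hf : InBloch n f)
    (hf1 : blochNorm n f ≤ 1) (hTf : BddAbove ((fun z => ‖T f z‖) '' polyDisc n))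
    {z : Fin n → ℂ} (hz : z ∈ polyDisc n) :
    ‖T f z - K f z‖ ≤ opNorm n (T - K) := by
  obtain ⟨C, hC⟩ := hT
  obtain ⟨M, hM⟩ := hK.exists_bound
  have key : ∀ g, InBloch n g → blochNorm n g ≤ 1 →
      BddAbove ((fun z => ‖T g z‖) '' polyDisc n) →
      ∀ w ∈ polyDisc n, ‖(T - K) g w‖ ≤ supNorm n (T g) + M := fun g hg hg1 hTg w hw =>
    (norm_sub_le _ _).trans (add_le_add (norm_le_supNorm hTg hw) (hM g hg hg1 w hw))
  have hbdd : BddAbove {t : ℝ | ∃ g, InBloch n g ∧ blochNorm n g ≤ 1 ∧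
      t = supNorm n ((T - K) g)} := by
    refine ⟨max 0 (|C| + M), ?_⟩
    rintro _ ⟨g, hg, hg1, rfl⟩
    by_cases hTg : BddAbove ((fun z => ‖T g z‖) '' polyDisc n)
    · refine le_max_of_le_right (supNorm_le fun w hw => (key g hg hg1 hTg w hw).trans ?_)
      have h0 : 0 ≤ blochNorm n g := by
        refine add_nonneg (norm_nonneg _) (Real.sSup_nonneg ?_)
        rintro _ ⟨u, hu, rfl⟩
        refine Finset.sum_nonneg fun j _ => mul_nonneg ?_ (norm_nonneg _)
        nlinarith [norm_apply_lt_one hu j, norm_nonneg (u j)]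
      have : C * blochNorm n g ≤ |C| := by
        nlinarith [le_abs_self C, abs_nonneg C]
      linarith [hC g hg]
    · refine le_max_of_le_left (supNorm_of_not_bddAbove fun hb => hTg ?_).le
      obtain ⟨B, hB⟩ := hb
      refine bddAbove_norm_image (M := B + M) fun w hw => ?_
      have h1 : ‖T g w - K g w‖ ≤ B := hB (mem_image_of_mem _ hw)
      have h2 := hM g hg hg1 w hw
      have h3 := norm_sub_norm_le (T g w) (K g w)
      linarith
  exact (norm_le_supNorm (bddAbove_norm_image (key f hf hf1 hTf)) hz).trans
    (le_csSup hbdd ⟨f, hf, hf1, rfl⟩)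

lemma normSq_one_sub_conj_mul (c w : ℂ) :
    ‖1 - (starRingEnd ℂ) c * w‖ ^ 2 - ‖w - c‖ ^ 2 = (1 - ‖w‖ ^ 2) * (1 - ‖c‖ ^ 2) := by
  simp only [← Complex.normSq_eq_norm_sq, Complex.normSq_apply, Complex.sub_re, Complex.sub_im,
    Complex.mul_re, Complex.mul_im, Complex.conj_re, Complex.conj_im, Complex.one_re,
    Complex.one_im]
  ring

lemma one_sub_conj_mul_ne_zero {c w : ℂ} (hc : ‖c‖ < 1) (hw : ‖w‖ < 1) :
    1 - (starRingEnd ℂ) c * w ≠ 0 := by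
  intro h
  have h1 : ‖(starRingEnd ℂ) c * w‖ = 1 := by rw [← sub_eq_zero.1 h, norm_one]
  rw [norm_mul, RCLike.norm_conj] at h1
  nlinarith [norm_nonneg c, norm_nonneg w]

lemma norm_mobius_apply_le_one {c w : ℂ} (hc : ‖c‖ < 1) (hw : ‖w‖ < 1) :
    ‖(w - c) / (1 - (starRingEnd ℂ) c * w)‖ ≤ 1 := by
  rw [norm_div]
  refine div_le_one_of_le₀ (abs_le_of_sq_le_sq' ?_ (norm_nonneg _)).2 (norm_nonneg _)
  have := normSq_one_sub_conj_mul c w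
  have : 0 ≤ (1 - ‖w‖ ^ 2) * (1 - ‖c‖ ^ 2) :=
    mul_nonneg (by nlinarith [norm_nonneg w]) (by nlinarith [norm_nonneg c])
  linarith

lemma hasDerivAt_mobius {c w : ℂ} (hc : ‖c‖ < 1) (hw : ‖w‖ < 1) :
    HasDerivAt (fun w => (w - c) / (1 - (starRingEnd ℂ) c * w))
      ((1 - (starRingEnd ℂ) c * c) / (1 - (starRingEnd ℂ) c * w) ^ 2) w := by
  have h := ((hasDerivAt_id w).sub_const c).div
    (((hasDerivAt_id w).const_mul ((starRingEnd ℂ) c)).const_sub 1)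
    (one_sub_conj_mul_ne_zero hc hw)
  refine h.congr_deriv ?_
  simp only [id]
  ring

lemma one_sub_sq_mul_norm_deriv_mobius_le {c w : ℂ} (hc : ‖c‖ < 1) (hw : ‖w‖ < 1) :
    (1 - ‖w‖ ^ 2) * ‖(1 - (starRingEnd ℂ) c * c) / (1 - (starRingEnd ℂ) c * w) ^ 2‖ ≤ 1 := by
  have h1 : ‖1 - (starRingEnd ℂ) c * c‖ = 1 - ‖c‖ ^ 2 := by
    rw [Complex.conj_mul', ← Complex.ofReal_pow, ← Complex.ofReal_one, ← Complex.ofReal_sub,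
      Complex.norm_real, Real.norm_of_nonneg (by nlinarith [norm_nonneg c])]
  have h2 : 0 < ‖1 - (starRingEnd ℂ) c * w‖ ^ 2 :=
    pow_pos (norm_pos_iff.2 (one_sub_conj_mul_ne_zero hc hw)) 2
  rw [norm_div, norm_pow, h1, ← mul_div_assoc, div_le_one h2]
  linarith [normSq_one_sub_conj_mul c w, sq_nonneg ‖w - c‖]

lemma one_sub_sq_mul_pow_le {r : ℝ} (h0 : 0 ≤ r) (h1 : r ≤ 1) (N : ℕ) :
    (1 - r ^ 2) * ((N + 1) * r ^ N) ≤ 1 - (r ^ (N + 1)) ^ 2 := by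
  induction N with
  | zero => simp
  | succ N ih =>
    have hs0 : 0 ≤ r ^ (N + 1) := by positivity
    have hs1 : r ^ (N + 1) ≤ 1 := pow_le_one₀ h0 h1
    have e1 : r ^ (N + 1 + 1) = r * r ^ (N + 1) := by ring
    have e2 : (1 - r ^ 2) * (((N + 1 : ℕ) + 1 : ℝ) * r ^ (N + 1)) =
        r * ((1 - r ^ 2) * ((N + 1) * r ^ N)) + (1 - r ^ 2) * r ^ (N + 1) := by
      push_cast; ring
    rw [e1, e2]
    set s := r ^ (N + 1)
    have hrs : r * s ≤ 1 := mul_le_one₀ h1 hs0 hs1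
    have h2 := mul_le_mul_of_nonneg_left ih h0
    have h3 : 0 ≤ (1 - r * s) * ((1 - r) * (1 - s)) :=
      mul_nonneg (by linarith) (mul_nonneg (by linarith) (by linarith))
    nlinarith

/-- The test function `w ↦ w_i^{N+1} (w_j - c)/(1 - conj(c) w_j) / 2`. -/
def testFun (n N : ℕ) (c : ℂ) (i j : Fin n) (w : Fin n → ℂ) : ℂ :=
  (1 / 2) * (w i ^ (N + 1) * ((w j - c) / (1 - (starRingEnd ℂ) c * w j)))

lemma hasFDerivAt_testFun {n : ℕ} (N : ℕ) {c : ℂ} (hc : ‖c‖ < 1) (i j : Fin n)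
    {w : Fin n → ℂ} (hw : w ∈ polyDisc n) :
    HasFDerivAt (testFun n N c i j)
      ((1 / 2 : ℂ) • (w i ^ (N + 1) •
          (((1 - (starRingEnd ℂ) c * c) / (1 - (starRingEnd ℂ) c * w j) ^ 2) •
            ContinuousLinearMap.proj (R := ℂ) (φ := fun _ : Fin n => ℂ) j) +
        ((w j - c) / (1 - (starRingEnd ℂ) c * w j)) •
          ((((N + 1 : ℕ) : ℂ) * w i ^ N) •
            ContinuousLinearMap.proj (R := ℂ) (φ := fun _ : Fin n => ℂ) i))) w := by
  have hi := (hasDerivAt_pow (N + 1) (w i)).comp_hasFDerivAt w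
    (hasFDerivAt_apply (𝕜 := ℂ) (F' := fun _ : Fin n => ℂ) i w)
  have hj := (hasDerivAt_mobius hc (norm_apply_lt_one hw j)).comp_hasFDerivAt w
    (hasFDerivAt_apply (𝕜 := ℂ) (F' := fun _ : Fin n => ℂ) j w)
  exact (hi.mul hj).const_mul (1 / 2 : ℂ)

lemma blochSum_testFun_le {n : ℕ} (N : ℕ) {c : ℂ} (hc : ‖c‖ < 1) (i j : Fin n)
    {w : Fin n → ℂ} (hw : w ∈ polyDisc n) : blochSum n (testFun n N c i j) w ≤ 1 := by
  have hwk := fun k => norm_apply_lt_one hw k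
  have hpos : ∀ k, 0 ≤ 1 - ‖w k‖ ^ 2 := fun k => by nlinarith [hwk k, norm_nonneg (w k)]
  set h := (w j - c) / (1 - (starRingEnd ℂ) c * w j) with hh
  set h' := (1 - (starRingEnd ℂ) c * c) / (1 - (starRingEnd ℂ) c * w j) ^ 2 with hh'
  have hle : ∀ k : Fin n, (1 - ‖w k‖ ^ 2) *
      ‖fderiv ℂ (testFun n N c i j) w (Pi.single k 1)‖ ≤
      (if k = j then 1 / 2 * ((1 - ‖w k‖ ^ 2) * ‖h'‖) else 0) +
      (if k = i then 1 / 2 * ((1 - ‖w k‖ ^ 2) * ((N + 1) * ‖w i‖ ^ N)) else 0) := by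
    intro k
    have hp1 : ‖w i‖ ^ (N + 1) ≤ 1 := pow_le_one₀ (norm_nonneg _) (hwk i).le
    have hh1 : ‖h‖ ≤ 1 := norm_mobius_apply_le_one hc (hwk j)
    have e : fderiv ℂ (testFun n N c i j) w (Pi.single k 1) =
        (1 / 2) * (w i ^ (N + 1) * (h' * if k = j then 1 else 0) +
          h * ((((N + 1 : ℕ) : ℂ) * w i ^ N) * if k = i then 1 else 0)) := by
      rw [(hasFDerivAt_testFun N hc i j hw).fderiv]
      simp [Pi.single_apply, hh, hh', eq_comm, mul_add]
    have e2 : ‖fderiv ℂ (testFun n N c i j) w (Pi.single k 1)‖ ≤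
        (1 / 2) * ((if k = j then ‖h'‖ else 0) +
          (if k = i then (N + 1) * ‖w i‖ ^ N else 0)) := by
      rw [e, norm_mul]
      have : ‖(1 / 2 : ℂ)‖ = 1 / 2 := by simp
      rw [this]
      refine mul_le_mul_of_nonneg_left ((norm_add_le _ _).trans (add_le_add ?_ ?_)) (by norm_num)
      · rw [norm_mul, norm_pow]
        refine (mul_le_of_le_one_left (norm_nonneg _) hp1).trans ?_
        split_ifs <;> simp
      · rw [norm_mul]
        refine (mul_le_of_le_one_left (norm_nonneg _) hh1).trans (le_of_eq ?_)
        split_ifs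
        · rw [mul_one, norm_mul, norm_pow, Complex.norm_natCast]; push_cast; rfl
        · simp
    refine (mul_le_mul_of_nonneg_left e2 (hpos k)).trans (le_of_eq ?_)
    split_ifs <;> ring
  refine (Finset.sum_le_sum fun k _ => hle k).trans ?_
  rw [Finset.sum_add_distrib]
  simp only [Finset.sum_ite_eq', Finset.mem_univ, if_true]
  have h1 := one_sub_sq_mul_norm_deriv_mobius_le hc (hwk j)
  have h2 := one_sub_sq_mul_pow_le (norm_nonneg (w i)) (hwk i).le N
  have h3 := sq_nonneg (‖w i‖ ^ (N + 1))
  linarith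

lemma norm_testFun_le {n : ℕ} (N : ℕ) {c : ℂ} (hc : ‖c‖ < 1) (i j : Fin n)
    {w : Fin n → ℂ} (hw : w ∈ polyDisc n) : ‖testFun n N c i j w‖ ≤ ‖w‖ ^ N := by
  have h1 := norm_mobius_apply_le_one hc (norm_apply_lt_one hw j)
  have h2 : ‖w i‖ ^ (N + 1) ≤ ‖w‖ ^ N :=
    (pow_le_pow_left₀ (norm_nonneg _) (norm_le_pi_norm w i) _).trans
      (pow_le_pow_of_le_one (norm_nonneg _) (le_of_lt hw) N.le_succ)
  have h3 : ‖(1 / 2 : ℂ)‖ = 1 / 2 := by simp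
  rw [testFun, norm_mul, norm_mul, norm_pow, h3]
  have h4 : ‖w i‖ ^ (N + 1) * ‖(w j - c) / (1 - (starRingEnd ℂ) c * w j)‖ ≤ ‖w i‖ ^ (N + 1) :=
    mul_le_of_le_one_right (by positivity) h1
  have h5 : 0 ≤ ‖w i‖ ^ (N + 1) := by positivity
  linarith

lemma norm_half_smul_sub_le {x y : ℝ} {a b : ℂ} (ha : ‖a‖ ≤ x) (hb : ‖b‖ ≤ y) :
    ‖(1 / 2 : ℂ) * (a + -1 * b)‖ ≤ (x + y) / 2 := by
  have h : ‖(1 / 2 : ℂ)‖ = 1 / 2 := by simp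
  rw [norm_mul, h, neg_one_mul, ← sub_eq_add_neg]
  linarith [norm_sub_le a b]

lemma blochSum_half_smul_sub_le {n : ℕ} {f g : (Fin n → ℂ) → ℂ} {w : Fin n → ℂ}
    (hw : w ∈ polyDisc n) (hf : DifferentiableAt ℂ f w) (hg : DifferentiableAt ℂ g w) :
    blochSum n ((1 / 2 : ℂ) • (f + (-1 : ℂ) • g)) w ≤ (blochSum n f w + blochSum n g w) / 2 := by
  rw [blochSum, blochSum, blochSum, ← Finset.sum_add_distrib, Finset.sum_div]
  refine Finset.sum_le_sum fun k _ => ?_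
  have hpos : 0 ≤ 1 - ‖w k‖ ^ 2 := by nlinarith [norm_apply_lt_one hw k, norm_nonneg (w k)]
  have e : fderiv ℂ ((1 / 2 : ℂ) • (f + (-1 : ℂ) • g)) w (Pi.single k 1) =
      (1 / 2) * (fderiv ℂ f w (Pi.single k 1) + -1 * fderiv ℂ g w (Pi.single k 1)) := by
    rw [fderiv_const_smul (hf.add (hg.const_smul _)), fderiv_add hf (hg.const_smul _),
      fderiv_const_smul hg]
    simp [mul_add]
  rw [e, ← mul_add, mul_div_assoc]
  exact mul_le_mul_of_nonneg_left (norm_half_smul_sub_le le_rfl le_rfl) hpos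

lemma blochNorm_le_one {n : ℕ} {f : (Fin n → ℂ) → ℂ} (h0 : f 0 = 0)
    (h : ∀ w ∈ polyDisc n, blochSum n f w ≤ 1) : blochNorm n f ≤ 1 := by
  rw [blochNorm, h0, norm_zero, zero_add]
  exact csSup_le (Set.Nonempty.image _ ⟨0, zero_mem_polyDisc n⟩)
    (forall_mem_image.2 h)

lemma testFun_zero (n N : ℕ) (c : ℂ) (i j : Fin n) : testFun n N c i j 0 = 0 := by
  simp [testFun]

lemma inBloch_testFun {n : ℕ} (N : ℕ) {c : ℂ} (hc : ‖c‖ < 1) (i j : Fin n) :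
    InBloch n (testFun n N c i j) :=
  ⟨fun _ hw => (hasFDerivAt_testFun N hc i j hw).differentiableAt.differentiableWithinAt,
    1, forall_mem_image.2 fun _ hw => blochSum_testFun_le N hc i j hw⟩

lemma norm_mobius_swap (n : ℕ) (a b : Fin n → ℂ) (j : Fin n) :
    ‖mobius n a b j‖ = ‖mobius n b a j‖ := by
  rw [mobius, mobius, norm_div, norm_div, norm_sub_rev (b j)]
  congr 1
  rw [← RCLike.norm_conj]
  congr 1
  simp [mul_comm]

lemma exists_norm_apply_gt {n : ℕ} {a : Fin n → ℂ} {r : ℝ} (hr : 0 ≤ r) (h : r < ‖a‖) :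
    ∃ i, r < ‖a i‖ := by
  by_contra! hcon
  exact absurd ((pi_norm_le_iff_of_nonneg hr).2 hcon) (not_le.2 h)

/-- Test functions separate `a` from `b` whenever one of them is near the boundary. -/
lemma exists_testFun_separating {n N : ℕ} {a b : Fin n → ℂ} (ha : a ∈ polyDisc n)
    (hb : b ∈ polyDisc n) {r t : ℝ} (hr : 0 ≤ r) (ht : 0 ≤ t) (hab : r < max ‖a‖ ‖b‖)
    (hm : t < ‖mobius n a b‖) :
    ∃ c i j, ‖c‖ < 1 ∧
      r ^ (N + 1) * t / 2 ≤ ‖testFun n N c i j a - testFun n N c i j b‖ := by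
  obtain ⟨j, hj⟩ := exists_norm_apply_gt ht hm
  have h2 : ‖(1 / 2 : ℂ)‖ = 1 / 2 := by simp
  have main : ∀ a b : Fin n → ℂ, r < ‖a‖ → t < ‖mobius n b a j‖ →
      ∃ i, r ^ (N + 1) * t / 2 ≤
        ‖testFun n N (b j) i j a - testFun n N (b j) i j b‖ := by
    intro a b hra htab
    obtain ⟨i, hi⟩ := exists_norm_apply_gt hr hra
    refine ⟨i, ?_⟩
    have hb0 : testFun n N (b j) i j b = 0 := by simp [testFun]
    have ha0 : testFun n N (b j) i j a = (1 / 2) * (a i ^ (N + 1) * mobius n b a j) := rfl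
    rw [hb0, sub_zero, ha0, norm_mul, norm_mul, norm_pow, h2]
    have := mul_le_mul (pow_le_pow_left₀ hr hi.le (N + 1)) htab.le ht (by positivity)
    linarith
  rcases lt_max_iff.1 hab with h | h
  · obtain ⟨i, hi⟩ := main a b h (by rwa [norm_mobius_swap])
    exact ⟨b j, i, j, norm_apply_lt_one hb j, hi⟩
  · obtain ⟨i, hi⟩ := main b a h hj
    exact ⟨a j, i, j, norm_apply_lt_one ha j, by rwa [norm_sub_rev]⟩

lemma isCompactOp_zero (n : ℕ) : IsCompactOp n 0 := by
  refine ⟨⟨by simp, by simp⟩, fun f _ => ⟨differentiableOn_const 0, ?_⟩, fun F _ => ?_⟩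
  · exact ⟨0, by rintro _ ⟨z, _, rfl⟩; simp⟩
  · refine ⟨id, strictMono_id, fun ε hε => ⟨0, fun k _ k' _ => supNorm_le fun z _ => ?_⟩⟩
    simpa using hε.le

/-- If, for every `N`, some test function of exponent `N + 1` has image under `C_φ - C_ψ` of size
at least `L / 2` somewhere, then every compact perturbation has norm at least `L / 4`. -/
lemma le_opNorm_sub_of_testFun {n : ℕ} {φ ψ : (Fin n → ℂ) → Fin n → ℂ}
    (hφm : MapsTo φ (polyDisc n) (polyDisc n)) (hψm : MapsTo ψ (polyDisc n) (polyDisc n))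
    (hbdd : IsBddOp n (compOpDiff n φ ψ)) {K : ((Fin n → ℂ) → ℂ) → (Fin n → ℂ) → ℂ}
    (hK : IsCompactOp n K) {L : ℝ}
    (h : ∀ N, ∃ z ∈ polyDisc n, ∃ c i j, ‖c‖ < 1 ∧
      L / 2 ≤ ‖testFun n N c i j (φ z) - testFun n N c i j (ψ z)‖) :
    L / 4 ≤ opNorm n (compOpDiff n φ ψ - K) := by
  choose z hz c i j hc hL using h
  set f : ℕ → (Fin n → ℂ) → ℂ := fun N => testFun n N (c N) (i N) (j N) with hf
  have hfB : ∀ N, InBloch n (f N) := fun N => inBloch_testFun N (hc N) (i N) (j N)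
  have hf1 : ∀ N, ∀ w ∈ polyDisc n, blochSum n (f N) w ≤ 1 := fun N w hw =>
    blochSum_testFun_le N (hc N) (i N) (j N) hw
  have hf0 : ∀ N, f N 0 = 0 := fun N => testFun_zero n N (c N) (i N) (j N)
  have hfle : ∀ N, ∀ w ∈ polyDisc n, ‖f N w‖ ≤ ‖w‖ ^ N := fun N w hw =>
    norm_testFun_le N (hc N) (i N) (j N) hw
  have hfle1 : ∀ N, ∀ w ∈ polyDisc n, ‖f N w‖ ≤ 1 := fun N w hw =>
    (hfle N w hw).trans (pow_le_one₀ (norm_nonneg _) (le_of_lt hw))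
  obtain ⟨s, hs, hC⟩ := hK.2.2 f fun N => ⟨hfB N, blochNorm_le_one (hf0 N) (hf1 N)⟩
  refine le_of_forall_pos_le_add fun ε hε => ?_
  obtain ⟨k, hk⟩ := hC (2 * ε) (by linarith)
  set x := z (s k)
  have hx : x ∈ polyDisc n := hz _
  have hstep : ∀ l ≥ k, L / 4 ≤ opNorm n (compOpDiff n φ ψ - K) + ε +
      (‖φ x‖ ^ s l + ‖ψ x‖ ^ s l) / 2 := by
    intro l hl
    set g : (Fin n → ℂ) → ℂ := (1 / 2 : ℂ) • (f (s k) + (-1 : ℂ) • f (s l)) with hg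
    have hgv : ∀ w, g w = (1 / 2) * (f (s k) w + -1 * f (s l) w) := fun w => rfl
    have hdiff : ∀ N, ∀ w ∈ polyDisc n, DifferentiableAt ℂ (f N) w := fun N w hw =>
      (hfB N).1.differentiableAt ((isOpen_polyDisc n).mem_nhds hw)
    have hg1 : ∀ w ∈ polyDisc n, blochSum n g w ≤ 1 := fun w hw => by
      refine (blochSum_half_smul_sub_le hw (hdiff _ w hw) (hdiff _ w hw)).trans ?_
      linarith [hf1 (s k) w hw, hf1 (s l) w hw]
    have hneg : InBloch n ((-1 : ℂ) • f (s l)) := by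
      refine ⟨(hfB _).1.const_smul _, 1, forall_mem_image.2 fun w hw => ?_⟩
      refine le_trans (le_of_eq ?_) (hf1 (s l) w hw)
      refine Finset.sum_congr rfl fun m _ => ?_
      rw [fderiv_const_smul (hdiff _ w hw)]
      simp
    have hsum : InBloch n (f (s k) + (-1 : ℂ) • f (s l)) := by
      refine ⟨(hfB _).1.add hneg.1, 2, forall_mem_image.2 fun w hw => ?_⟩
      have e : blochSum n (f (s k) + (-1 : ℂ) • f (s l)) w = 2 * blochSum n g w := by
        rw [blochSum, blochSum, Finset.mul_sum]
        refine Finset.sum_congr rfl fun m _ => ?_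
        rw [hg, fderiv_const_smul ((hdiff _ w hw).add ((hdiff _ w hw).const_smul _))]
        simp only [smul_apply, norm_smul]
        norm_num
        ring
      linarith [hg1 w hw]
    have hgB : InBloch n g :=
      ⟨hsum.1.const_smul _, 1, forall_mem_image.2 hg1⟩
    have hg0 : g 0 = 0 := by rw [hgv, hf0, hf0]; simp
    have hgle : ∀ w ∈ polyDisc n, ‖g w‖ ≤ 1 := fun w hw => by
      rw [hgv]
      linarith [norm_half_smul_sub_le (hfle1 (s k) w hw) (hfle1 (s l) w hw)]
    have hTg : BddAbove ((fun w => ‖compOpDiff n φ ψ g w‖) '' polyDisc n) :=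
      bddAbove_norm_image (M := 1 + 1) fun w hw =>
        (norm_sub_le _ _).trans (add_le_add (hgle _ (hφm hw)) (hgle _ (hψm hw)))
    have hA := norm_sub_apply_le_opNorm hbdd hK hgB (blochNorm_le_one hg0 hg1) hTg hx
    have hKg : K g x = (1 / 2) * (K (f (s k)) x - K (f (s l)) x) := by
      rw [hg, hK.1.2 _ _ hsum x hx, hK.1.1 _ _ (hfB _) hneg x hx, hK.1.2 _ _ (hfB _) x hx]
      ring
    have hKle : ‖K (f (s k)) x - K (f (s l)) x‖ ≤ 2 * ε := by
      obtain ⟨B, hB⟩ := (hK.2.1 _ (hfB (s k))).2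
      obtain ⟨B', hB'⟩ := (hK.2.1 _ (hfB (s l))).2
      have hb : BddAbove ((fun w => ‖(K (f (s k)) - K (f (s l))) w‖) '' polyDisc n) :=
        bddAbove_norm_image (M := B + B') fun w hw => (norm_sub_le _ _).trans
          (add_le_add (hB (mem_image_of_mem _ hw)) (hB' (mem_image_of_mem _ hw)))
      exact (norm_le_supNorm hb hx).trans (hk k le_rfl l hl)
    have hTgx : compOpDiff n φ ψ g x = (1 / 2) * (f (s k) (φ x) - f (s k) (ψ x)) -
        (1 / 2) * (f (s l) (φ x) - f (s l) (ψ x)) := by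
      change g (φ x) - g (ψ x) = _
      rw [hgv, hgv]
      ring
    have hhalf : ‖(1 / 2 : ℂ)‖ = 1 / 2 := by simp
    have hsplit : (1 / 2 : ℂ) * (f (s k) (φ x) - f (s k) (ψ x)) =
        (compOpDiff n φ ψ g x - K g x) + (1 / 2) * (K (f (s k)) x - K (f (s l)) x) +
          (1 / 2) * (f (s l) (φ x) - f (s l) (ψ x)) := by
      rw [hTgx, hKg]
      ring
    have hnorm := norm_add₃_le (a := compOpDiff n φ ψ g x - K g x)
      (b := (1 / 2) * (K (f (s k)) x - K (f (s l)) x))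
      (c := (1 / 2) * (f (s l) (φ x) - f (s l) (ψ x)))
    rw [← hsplit, norm_mul, norm_mul, norm_mul, hhalf] at hnorm
    have hl' := (norm_sub_le (f (s l) (φ x)) (f (s l) (ψ x))).trans
      (add_le_add (hfle (s l) _ (hφm hx)) (hfle (s l) _ (hψm hx)))
    have hk' : L / 2 ≤ ‖f (s k) (φ x) - f (s k) (ψ x)‖ := hL (s k)
    linarith
  have hpow : ∀ w ∈ polyDisc n, Tendsto (fun l => ‖w‖ ^ s l) atTop (𝓝 0) := fun w hw =>
    (tendsto_pow_atTop_nhds_zero_of_lt_one (norm_nonneg w) hw).comp hs.tendsto_atTop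
  have hlim : Tendsto (fun l => opNorm n (compOpDiff n φ ψ - K) + ε +
      (‖φ x‖ ^ s l + ‖ψ x‖ ^ s l) / 2) atTop
      (𝓝 (opNorm n (compOpDiff n φ ψ - K) + ε + (0 + 0) / 2)) :=
    tendsto_const_nhds.add (((hpow _ (hφm hx)).add (hpow _ (hψm hx))).div_const 2)
  have := ge_of_tendsto hlim ((eventually_ge_atTop k).mono hstep)
  simpa using this

/-- **lower estimate of the essential norm.** If `φ, ψ : Uⁿ → Uⁿ` are
holomorphic and `C_φ - C_ψ : B → H^∞` is bounded, then
`‖C_φ - C_ψ‖_e ≥ (1/4) lim_{δ→0⁺} sup_{z ∈ E_δ} |||φ_{φ(z)}(ψ(z))|||`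
(the limit equals the infimum over `δ > 0`, the supremum being monotone in `δ`). -/
theorem essNorm_diff_ge (n : ℕ) (hn : 0 < n)
    (φ ψ : (Fin n → ℂ) → Fin n → ℂ)
    (hφ : DifferentiableOn ℂ φ (polyDisc n)) (hφm : MapsTo φ (polyDisc n) (polyDisc n))
    (hψ : DifferentiableOn ℂ ψ (polyDisc n)) (hψm : MapsTo ψ (polyDisc n) (polyDisc n))
    (hbdd : IsBddOp n (compOpDiff n φ ψ)) :
    (1 / 4 : ℝ) *
        (⨅ δ : {d : ℝ // 0 < d},
          sSup ((fun z => ‖mobius n (φ z) (ψ z)‖) '' Eset n φ ψ (δ : ℝ))) ≤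
      essNorm n (compOpDiff n φ ψ) := by
  refine le_csInf ⟨_, 0, isCompactOp_zero n, rfl⟩ ?_
  rintro _ ⟨K, hK, rfl⟩
  set S : {d : ℝ // 0 < d} → ℝ := fun δ =>
    sSup ((fun z => ‖mobius n (φ z) (ψ z)‖) '' Eset n φ ψ (δ : ℝ)) with hS
  have hbelow : BddBelow (range S) := by
    refine ⟨0, ?_⟩
    rintro _ ⟨δ, rfl⟩
    exact Real.sSup_nonneg (forall_mem_image.2 fun _ _ => norm_nonneg _)
  have hop : 0 ≤ opNorm n (compOpDiff n φ ψ - K) := by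
    refine Real.sSup_nonneg ?_
    rintro _ ⟨f, -, -, rfl⟩
    exact Real.iSup_nonneg fun _ => norm_nonneg _
  suffices h : ∀ L, 0 < L → L < iInf S → L / 4 ≤ opNorm n (compOpDiff n φ ψ - K) by
    by_contra! hcon
    have h4 : 4 * opNorm n (compOpDiff n φ ψ - K) < iInf S := by linarith
    obtain ⟨L, hL1, hL2⟩ := exists_between h4
    linarith [h L (by linarith) hL2]
  intro L hL0 hL
  refine le_opNorm_sub_of_testFun hφm hψm hbdd hK fun N => ?_
  obtain ⟨t, ht1, ht2⟩ := exists_between hL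
  have hcont : Tendsto (fun δ : ℝ => (1 - δ) ^ (N + 1) * t) (𝓝[>] 0) (𝓝 t) := by
    have : Continuous fun δ : ℝ => (1 - δ) ^ (N + 1) * t := by fun_prop
    simpa using (this.tendsto 0).mono_left nhdsWithin_le_nhds
  obtain ⟨δ, hδt, hδ0, hδ1⟩ := ((hcont.eventually_const_lt ht1).and
    (Ioo_mem_nhdsGT (one_pos : (0 : ℝ) < 1))).exists
  have hSδ : t < S ⟨δ, hδ0⟩ := ht2.trans_le (ciInf_le hbelow _)
  have hne : ((fun z => ‖mobius n (φ z) (ψ z)‖) '' Eset n φ ψ δ).Nonempty := by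
    rw [nonempty_iff_ne_empty]
    intro he
    simp only [hS, he, Real.sSup_empty] at hSδ
    linarith
  obtain ⟨_, ⟨z, ⟨hz, hzδ⟩, rfl⟩, hzt⟩ := exists_lt_of_lt_csSup hne hSδ
  obtain ⟨c, i, j, hc, hcij⟩ := exists_testFun_separating (N := N) (hφm hz) (hψm hz)
    (by linarith) (by linarith) hzδ hzt
  exact ⟨z, hz, c, i, j, hc, by linarith⟩

end
end

section
/- Let φ : U^n → U^n be holomorphic and let 0 < r < 1. Then the composition operator C_{rφ} : B → H^∞, f ↦ f∘(rφ), is a compact linear operator from the Bloch space B of U^n to H^∞(U^n). -/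
open Complex Metric Set Filter
open scoped Topology BigOperators

noncomputable section

theorem polyDisc_eq_ball (n : ℕ) : polyDisc n = ball (0 : Fin n → ℂ) 1 := by
  ext z
  simp [polyDisc]

theorem blochSum_nonneg {n : ℕ} (f : (Fin n → ℂ) → ℂ) {z : Fin n → ℂ} (hz : z ∈ polyDisc n) :
    0 ≤ blochSum n f z := by
  refine Finset.sum_nonneg fun j _ => mul_nonneg ?_ (norm_nonneg _)
  have hj : ‖z j‖ < 1 := (norm_le_pi_norm z j).trans_lt hz
  nlinarith [norm_nonneg (z j)]

theorem norm_apply_zero_le_blochNorm (n : ℕ) (f : (Fin n → ℂ) → ℂ) : ‖f 0‖ ≤ blochNorm n f := by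
  refine le_add_of_nonneg_right (Real.sSup_nonneg ?_)
  rintro _ ⟨z, hz, rfl⟩
  exact blochSum_nonneg f hz

theorem InBloch.blochSum_le {n : ℕ} {f : (Fin n → ℂ) → ℂ} (hf : InBloch n f) {z : Fin n → ℂ}
    (hz : z ∈ polyDisc n) : blochSum n f z ≤ blochNorm n f :=
  (le_csSup hf.2 (mem_image_of_mem _ hz)).trans (le_add_of_nonneg_left (norm_nonneg _))

theorem norm_le_sum_norm_apply_single {n : ℕ} (L : (Fin n → ℂ) →L[ℂ] ℂ) :
    ‖L‖ ≤ ∑ j, ‖L (Pi.single j 1)‖ := by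
  refine L.opNorm_le_bound (Finset.sum_nonneg fun _ _ => norm_nonneg _) fun v => ?_
  have hv : L v = ∑ j, v j * L (Pi.single j 1) := by
    conv_lhs => rw [pi_eq_sum_univ' v]
    simp
  rw [hv, Finset.sum_mul]
  refine (norm_sum_le _ _).trans (Finset.sum_le_sum fun j _ => ?_)
  rw [norm_mul, mul_comm]
  exact mul_le_mul_of_nonneg_left (norm_le_pi_norm v j) (norm_nonneg _)

theorem norm_fderiv_le_blochSum_div {n : ℕ} (f : (Fin n → ℂ) → ℂ) {r : ℝ} (hr : r < 1)
    {z : Fin n → ℂ} (hz : ‖z‖ ≤ r) : ‖fderiv ℂ f z‖ ≤ blochSum n f z / (1 - r ^ 2) := by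
  have hr0 : 0 ≤ r := (norm_nonneg z).trans hz
  rw [le_div_iff₀ (by nlinarith)]
  calc ‖fderiv ℂ f z‖ * (1 - r ^ 2)
      ≤ (∑ j, ‖fderiv ℂ f z (Pi.single j 1)‖) * (1 - r ^ 2) :=
        mul_le_mul_of_nonneg_right (norm_le_sum_norm_apply_single _) (by nlinarith)
    _ ≤ blochSum n f z := by
        rw [mul_comm, Finset.mul_sum]
        refine Finset.sum_le_sum fun j _ => mul_le_mul_of_nonneg_right ?_ (norm_nonneg _)
        have hj : ‖z j‖ ≤ r := (norm_le_pi_norm z j).trans hz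
        gcongr

theorem closedBall_subset_polyDisc (n : ℕ) {r : ℝ} (hr : r < 1) :
    closedBall (0 : Fin n → ℂ) r ⊆ polyDisc n :=
  polyDisc_eq_ball n ▸ closedBall_subset_ball hr

theorem InBloch.norm_sub_le {n : ℕ} {f : (Fin n → ℂ) → ℂ} (hf : InBloch n f) {r : ℝ}
    (hr0 : 0 ≤ r) (hr : r < 1) {z w : Fin n → ℂ} (hz : z ∈ closedBall 0 r)
    (hw : w ∈ closedBall 0 r) : ‖f z - f w‖ ≤ blochNorm n f / (1 - r ^ 2) * ‖z - w‖ := by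
  have hsub := closedBall_subset_polyDisc n hr
  have hopen : IsOpen (polyDisc n) := polyDisc_eq_ball n ▸ isOpen_ball
  refine (convex_closedBall (0 : Fin n → ℂ) r).norm_image_sub_le_of_norm_fderiv_le (𝕜 := ℂ)
    (fun x hx => hf.1.differentiableAt (hopen.mem_nhds (hsub hx))) (fun x hx => ?_) hw hz
  refine (norm_fderiv_le_blochSum_div f hr (mem_closedBall_zero_iff.1 hx)).trans ?_
  exact div_le_div_of_nonneg_right (hf.blochSum_le (hsub hx)) (by nlinarith)

/-- Montel-type property: a sequence in the unit ball of the Bloch space has a subsequence that is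
uniformly Cauchy on the closed polydisc of radius `r < 1`. -/
theorem exists_subseq_cauchy_on_closedBall {n : ℕ} {r : ℝ} (hr0 : 0 ≤ r) (hr : r < 1)
    (F : ℕ → (Fin n → ℂ) → ℂ) (hF : ∀ m, InBloch n (F m) ∧ blochNorm n (F m) ≤ 1) :
    ∃ s : ℕ → ℕ, StrictMono s ∧ ∀ ε : ℝ, 0 < ε → ∃ N : ℕ, ∀ k ≥ N, ∀ k' ≥ N,
      ∀ z ∈ closedBall (0 : Fin n → ℂ) r, ‖F (s k) z - F (s k') z‖ ≤ ε := by
  have hpos : 0 < 1 - r ^ 2 := by nlinarith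
  have hlip : ∀ m, ∀ z ∈ closedBall (0 : Fin n → ℂ) r, ∀ w ∈ closedBall (0 : Fin n → ℂ) r,
      ‖F m z - F m w‖ ≤ 1 / (1 - r ^ 2) * ‖z - w‖ := fun m z hz w hw =>
    ((hF m).1.norm_sub_le hr0 hr hz hw).trans <| mul_le_mul_of_nonneg_right
      (div_le_div_of_nonneg_right (hF m).2 hpos.le) (norm_nonneg _)
  let C : NNReal := ⟨1 / (1 - r ^ 2), by positivity⟩
  have hlipW : ∀ m, LipschitzWith C fun z : closedBall (0 : Fin n → ℂ) r => F m z := fun m =>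
    LipschitzWith.of_dist_le_mul fun z w => by
      rw [dist_eq_norm, Subtype.dist_eq, dist_eq_norm]
      exact hlip m z z.2 w w.2
  have : CompactSpace (closedBall (0 : Fin n → ℂ) r) :=
    isCompact_iff_compactSpace.1 (isCompact_closedBall _ _)
  let g : ℕ → BoundedContinuousFunction (closedBall (0 : Fin n → ℂ) r) ℂ := fun m =>
    BoundedContinuousFunction.mkOfCompact ⟨_, (hlipW m).continuous⟩
  have hcomp : IsCompact (closure (range g)) := by
    refine BoundedContinuousFunction.arzela_ascoli (closedBall 0 (1 + 1 / (1 - r ^ 2) * r))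
      (isCompact_closedBall _ _) _ ?_ ?_
    · rintro _ z ⟨m, rfl⟩
      have h0 := (norm_apply_zero_le_blochNorm n (F m)).trans (hF m).2
      have hz := hlip m z z.2 0 (mem_closedBall_self hr0)
      rw [sub_zero] at hz
      have hzr : 1 / (1 - r ^ 2) * ‖(z : Fin n → ℂ)‖ ≤ 1 / (1 - r ^ 2) * r :=
        mul_le_mul_of_nonneg_left (mem_closedBall_zero_iff.1 z.2) (by positivity)
      rw [mem_closedBall_zero_iff]
      change ‖F m z‖ ≤ _
      have := norm_le_norm_sub_add (F m z) (F m 0)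
      linarith
    · refine (LipschitzWith.uniformEquicontinuous _ C ?_).equicontinuous
      rintro ⟨_, m, rfl⟩
      exact hlipW m
  obtain ⟨_, -, s, hs, hlim⟩ :=
    hcomp.tendsto_subseq fun m => subset_closure (mem_range_self (f := g) m)
  refine ⟨s, hs, fun ε hε => ?_⟩
  obtain ⟨N, hN⟩ := Metric.cauchySeq_iff.1 hlim.cauchySeq ε hε
  refine ⟨N, fun k hk k' hk' z hz => ?_⟩
  rw [← dist_eq_norm]
  exact ((g (s k)).dist_coe_le_dist (g := g (s k')) ⟨z, hz⟩).trans (hN k hk k' hk').le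

/-- If `φ : Uⁿ → Uⁿ` is holomorphic and `0 < r < 1`, then the composition
operator `C_{rφ} : B → H^∞`, `f ↦ f ∘ (rφ)`, is a compact linear operator from the Bloch
space of `Uⁿ` to `H^∞(Uⁿ)`. -/
theorem compOp_dilation_compact (n : ℕ) (hn : 0 < n) (r : ℝ) (hr0 : 0 < r) (hr1 : r < 1)
    (φ : (Fin n → ℂ) → Fin n → ℂ)
    (hφ : DifferentiableOn ℂ φ (polyDisc n)) (hφm : MapsTo φ (polyDisc n) (polyDisc n)) :
    IsCompactOp n (fun f => fun z => f ((r : ℂ) • φ z)) := by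
  have hmem : ∀ z ∈ polyDisc n, (r : ℂ) • φ z ∈ closedBall (0 : Fin n → ℂ) r := fun z hz => by
    have hφz : ‖φ z‖ < 1 := hφm hz
    rw [mem_closedBall_zero_iff, norm_smul, Complex.norm_real, Real.norm_of_nonneg hr0.le]
    nlinarith
  have hsub := closedBall_subset_polyDisc n hr1
  refine ⟨⟨fun _ _ _ _ _ _ => rfl, fun _ _ _ _ _ => rfl⟩, fun f hf => ⟨?_, ?_⟩, fun F hF => ?_⟩
  · exact hf.1.comp (hφ.const_smul (r : ℂ)) fun z hz => hsub (hmem z hz)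
  · refine ((isCompact_closedBall (0 : Fin n → ℂ) r).bddAbove_image
      (hf.1.continuousOn.mono hsub).norm).mono ?_
    rintro _ ⟨z, hz, rfl⟩
    exact ⟨_, hmem z hz, rfl⟩
  · obtain ⟨s, hs, hcauchy⟩ := exists_subseq_cauchy_on_closedBall hr0.le hr1 F hF
    refine ⟨s, hs, fun ε hε => ?_⟩
    obtain ⟨N, hN⟩ := hcauchy ε hε
    exact ⟨N, fun k hk k' hk' =>
      Real.iSup_le (fun z => hN k hk k' hk' _ (hmem z z.2)) hε.le⟩

end
end
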